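/- arXiv:2408.08286 — 3 statements merged into one kernel-verified Lean document; each statement's English description precedes it below -/
import Mathlib

section
/- The curve γ(t) = (w₁(t), b₁(t), w₂(t), b₂(t)) = (0, b̂, aσ(b̂)e^{−ωt}, ae^{−ωt} + ȳ) is an integral curve of the gradient flow of R; that is, for every t ∈ ℝ: w₁'(t) = −Σᵢ(w₂σ(w₁xᵢ+b₁)+b₂−yᵢ)·w₂σ'(w₁xᵢ+b₁)·xᵢ, b₁'(t) = −Σᵢ(w₂σ(w₁xᵢ+b₁)+b₂−yᵢ)·w₂σ'(w₁xᵢ+b₁), w₂'(t) = −Σᵢ(w₂σ(w₁xᵢ+b₁)+b₂−yᵢ)·σ(w₁xᵢ+b₁), and b₂'(t) = −Σᵢ(w₂σ(w₁xᵢ+b₁)+b₂−yᵢ), where all parameters on the right-hand sides are evaluated along γ(t). -/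
open Finset

/-- The curve `γ(t) = (0, b̂, a σ(b̂) e^{−ωt}, a e^{−ωt} + ȳ)` is an integral curve of
the gradient flow of the two-layer-network loss
`R(w₁,b₁,w₂,b₂) = ½ Σᵢ (w₂ σ(w₁xᵢ + b₁) + b₂ − yᵢ)²`. -/
theorem gamma_is_integral_curve_of_gradient_flow
    (N : ℕ) (hN : 1 ≤ N) (x y : Fin N → ℝ)
    (σ : ℝ → ℝ) (hσ : ContDiff ℝ 2 σ)
    (bhat : ℝ) (hbhat : deriv σ bhat = 0) (bhat₂ : ℝ)
    (ybar a ω : ℝ)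
    (hybar : ybar = (∑ i, y i) / N)
    (ha : a = bhat₂ - ybar)
    (hω : ω = N * (σ bhat ^ 2 + 1))
    (w₁ b₁ w₂ b₂ : ℝ → ℝ)
    (hw₁ : ∀ t, w₁ t = 0)
    (hb₁ : ∀ t, b₁ t = bhat)
    (hw₂ : ∀ t, w₂ t = a * σ bhat * Real.exp (-(ω * t)))
    (hb₂ : ∀ t, b₂ t = a * Real.exp (-(ω * t)) + ybar) :
    ∀ t : ℝ,
      HasDerivAt w₁
        (-(∑ i, (w₂ t * σ (w₁ t * x i + b₁ t) + b₂ t - y i) *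
            (w₂ t * deriv σ (w₁ t * x i + b₁ t)) * x i)) t ∧
      HasDerivAt b₁
        (-(∑ i, (w₂ t * σ (w₁ t * x i + b₁ t) + b₂ t - y i) *
            (w₂ t * deriv σ (w₁ t * x i + b₁ t)))) t ∧
      HasDerivAt w₂
        (-(∑ i, (w₂ t * σ (w₁ t * x i + b₁ t) + b₂ t - y i) *
            σ (w₁ t * x i + b₁ t))) t ∧
      HasDerivAt b₂
        (-(∑ i, (w₂ t * σ (w₁ t * x i + b₁ t) + b₂ t - y i))) t := by
  intro t
  have hN' : (N : ℝ) ≠ 0 := by positivity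
  have hexp : HasDerivAt (fun s => Real.exp (-(ω * s))) (Real.exp (-(ω * t)) * -(ω * 1)) t :=
    ((hasDerivAt_id t).const_mul ω).neg.exp
  have hsum : ∑ i, (w₂ t * σ (w₁ t * x i + b₁ t) + b₂ t - y i) =
      ω * (a * Real.exp (-(ω * t))) := by
    have hy : ∑ i, y i = N * ybar := by rw [hybar]; field_simp
    simp only [hw₁, hb₁, hw₂, hb₂, zero_mul, zero_add, sum_sub_distrib, sum_const, card_univ,
      Fintype.card_fin, nsmul_eq_mul, hy]
    linear_combination (-(a * Real.exp (-(ω * t)))) * hω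
  refine ⟨?_, ?_, ?_, ?_⟩
  · rw [funext hw₁]
    simpa [hb₁, hbhat] using hasDerivAt_const t (0 : ℝ)
  · rw [funext hb₁]
    simpa [hw₁, hbhat] using hasDerivAt_const t bhat
  · have hfactor : ∑ i, (w₂ t * σ (w₁ t * x i + b₁ t) + b₂ t - y i) *
        σ (w₁ t * x i + b₁ t) = ω * (a * Real.exp (-(ω * t))) * σ bhat := by
      rw [← hsum, sum_mul]
      simp only [hw₁, hb₁, zero_mul, zero_add]
    rw [hfactor, funext hw₂]
    exact (hexp.const_mul (a * σ bhat)).congr_deriv (by ring)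
  · rw [hsum, funext hb₂]
    exact ((hexp.const_mul a).add_const ybar).congr_deriv (by ring)
end

section
/- The Jacobian matrix of the negative-gradient vector field F = −∇R, evaluated at the point γ(t), has the following entries for every t ∈ ℝ: ∂F_{w₁}/∂w₁ = −Σᵢ(a(ω/N)e^{−ωt}+ȳ−yᵢ)·aσ(b̂)σ''(b̂)e^{−ωt}·xᵢ², ∂F_{w₁}/∂b₁ = ∂F_{b₁}/∂w₁ = −Σᵢ(a(ω/N)e^{−ωt}+ȳ−yᵢ)·aσ(b̂)σ''(b̂)e^{−ωt}·xᵢ, ∂F_{b₁}/∂b₁ = −Σᵢ(a(ω/N)e^{−ωt}+ȳ−yᵢ)·aσ(b̂)σ''(b̂)e^{−ωt}, ∂F_{w₂}/∂w₂ = −Nσ(b̂)², ∂F_{w₂}/∂b₂ = ∂F_{b₂}/∂w₂ = −Nσ(b̂), ∂F_{b₂}/∂b₂ = −N, and all remaining entries (namely ∂F_{w₁}/∂w₂, ∂F_{w₁}/∂b₂, ∂F_{b₁}/∂w₂, ∂F_{b₁}/∂b₂, ∂F_{w₂}/∂w₁, ∂F_{w₂}/∂b₁, ∂F_{b₂}/∂w₁,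 ∂F_{b₂}/∂b₁) are zero. Consequently the variational equation along γ splits into a block for (ε_{w₁}, ε_{b₁}) and a block for (ε_{w₂}, ε_{b₂}). -/
open Finset

section LossDerivatives

variable {σ w b u c : ℝ → ℝ} {w' b' u' c' s : ℝ}

/-- Chain rule for the residual of a single neuron along a curve of parameters. -/
lemma hasDerivAt_residual (hσ : Differentiable ℝ σ)
    (hw : HasDerivAt w w' s) (hb : HasDerivAt b b' s)
    (hu : HasDerivAt u u' s) (hc : HasDerivAt c c' s) (x y : ℝ) :
    HasDerivAt (fun s => u s * σ (w s * x + b s) + c s - y)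
      (u' * σ (w s * x + b s) + u s * (deriv σ (w s * x + b s) * (w' * x + b')) + c') s :=
  ((hu.mul ((hσ _).hasDerivAt.comp s ((hw.mul_const x).add hb))).add hc).sub_const y

/-- Derivative of the quadratic loss along a curve of parameters. -/
lemma deriv_quadratic_loss {N : ℕ} (hσ : Differentiable ℝ σ)
    (hw : HasDerivAt w w' s) (hb : HasDerivAt b b' s)
    (hu : HasDerivAt u u' s) (hc : HasDerivAt c c' s) (x y : Fin N → ℝ) :
    deriv (fun s => (1 / 2) * ∑ i, (u s * σ (w s * x i + b s) + c s - y i) ^ 2) s =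
      ∑ i, (u s * σ (w s * x i + b s) + c s - y i) *
        (u' * σ (w s * x i + b s) + u s * (deriv σ (w s * x i + b s) * (w' * x i + b')) + c') := by
  have h := (HasDerivAt.fun_sum (u := univ) fun i _ =>
    (hasDerivAt_residual hσ hw hb hu hc (x i) (y i)).fun_pow 2).const_mul (1 / 2 : ℝ)
  rw [h.deriv, mul_sum]
  refine sum_congr rfl fun i _ => ?_
  norm_num
  ring

/-- Derivative of an inner-layer component of the negative gradient, where the inner bias is a
critical point of the activation and the inner weight vanishes. -/
lemma deriv_inner_component {N : ℕ} (hσ : Differentiable ℝ σ) (hσ' : Differentiable ℝ (deriv σ))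
    (hw : HasDerivAt w w' s) (hb : HasDerivAt b b' s)
    (hu : HasDerivAt u u' s) (hc : HasDerivAt c c' s)
    (hw0 : w s = 0) (hcrit : deriv σ (b s) = 0) (x y k : Fin N → ℝ) :
    deriv (fun s => -∑ i, (u s * σ (w s * x i + b s) + c s - y i) *
        (u s * (deriv σ (w s * x i + b s) * k i))) s =
      -∑ i, (u s * σ (b s) + c s - y i) *
        (u s * (deriv (deriv σ) (b s) * (w' * x i + b') * k i)) := by
  have h := (HasDerivAt.fun_sum (u := univ) fun i _ =>
    (hasDerivAt_residual hσ hw hb hu hc (x i) (y i)).fun_mul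
      (hu.fun_mul (((hσ' _).hasDerivAt.comp s
        ((hw.mul_const (x i)).fun_add hb)).mul_const (k i)))).fun_neg
  refine h.deriv.trans ?_
  simp [hw0, hcrit]

/-- Derivative of the outer-weight component of the negative gradient, where the inner bias is a
critical point of the activation and the inner weight vanishes. -/
lemma deriv_outer_weight_component {N : ℕ} (hσ : Differentiable ℝ σ)
    (hw : HasDerivAt w w' s) (hb : HasDerivAt b b' s)
    (hu : HasDerivAt u u' s) (hc : HasDerivAt c c' s)
    (hw0 : w s = 0) (hcrit : deriv σ (b s) = 0) (x y : Fin N → ℝ) :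
    deriv (fun s => -∑ i, (u s * σ (w s * x i + b s) + c s - y i) * σ (w s * x i + b s)) s =
      -(N * ((u' * σ (b s) + c') * σ (b s))) := by
  have h := (HasDerivAt.fun_sum (u := univ) fun i _ =>
    (hasDerivAt_residual hσ hw hb hu hc (x i) (y i)).fun_mul
      ((hσ _).hasDerivAt.comp s ((hw.mul_const (x i)).fun_add hb))).fun_neg
  refine h.deriv.trans ?_
  simp [hw0, hcrit]

/-- Derivative of the outer-bias component of the negative gradient, where the inner bias is a
critical point of the activation and the inner weight vanishes. -/
lemma deriv_outer_bias_component {N : ℕ} (hσ : Differentiable ℝ σ)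
    (hw : HasDerivAt w w' s) (hb : HasDerivAt b b' s)
    (hu : HasDerivAt u u' s) (hc : HasDerivAt c c' s)
    (hw0 : w s = 0) (hcrit : deriv σ (b s) = 0) (x y : Fin N → ℝ) :
    deriv (fun s => -∑ i, (u s * σ (w s * x i + b s) + c s - y i)) s =
      -(N * (u' * σ (b s) + c')) := by
  have h := (HasDerivAt.fun_sum (u := univ) fun i _ =>
    hasDerivAt_residual hσ hw hb hu hc (x i) (y i)).fun_neg
  refine h.deriv.trans ?_
  simp [hw0, hcrit, -neg_add_rev, mul_add]

end LossDerivatives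

/-- Entries of the Jacobian of the negative-gradient vector field `F = −∇R` of the
two-layer-network loss `R`, evaluated along the integral curve
`γ(t) = (0, b̂, a σ(b̂) e^{−ωt}, a e^{−ωt} + ȳ)`.  The `(w₁,b₁)` and `(w₂,b₂)` blocks
have the stated entries and all cross entries vanish. -/
theorem jacobian_of_negative_gradient_along_gamma
    (N : ℕ) (hN : 1 ≤ N) (x y : Fin N → ℝ)
    (σ : ℝ → ℝ) (hσ : ContDiff ℝ 2 σ)
    (bhat : ℝ) (hbhat : deriv σ bhat = 0) (bhat₂ : ℝ)
    (ybar a ω : ℝ)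
    (hybar : ybar = (∑ i, y i) / N)
    (ha : a = bhat₂ - ybar)
    (hω : ω = N * (σ bhat ^ 2 + 1))
    (R : ℝ → ℝ → ℝ → ℝ → ℝ)
    (hR : ∀ w₁ b₁ w₂ b₂, R w₁ b₁ w₂ b₂ =
      (1 / 2) * ∑ i, (w₂ * σ (w₁ * x i + b₁) + b₂ - y i) ^ 2)
    (F₁ F₂ F₃ F₄ : ℝ → ℝ → ℝ → ℝ → ℝ)
    (hF₁ : ∀ w₁ b₁ w₂ b₂, F₁ w₁ b₁ w₂ b₂ = -deriv (fun s => R s b₁ w₂ b₂) w₁)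
    (hF₂ : ∀ w₁ b₁ w₂ b₂, F₂ w₁ b₁ w₂ b₂ = -deriv (fun s => R w₁ s w₂ b₂) b₁)
    (hF₃ : ∀ w₁ b₁ w₂ b₂, F₃ w₁ b₁ w₂ b₂ = -deriv (fun s => R w₁ b₁ s b₂) w₂)
    (hF₄ : ∀ w₁ b₁ w₂ b₂, F₄ w₁ b₁ w₂ b₂ = -deriv (fun s => R w₁ b₁ w₂ s) b₂)
    (w₂γ b₂γ : ℝ → ℝ)
    (hw₂γ : ∀ t, w₂γ t = a * σ bhat * Real.exp (-(ω * t)))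
    (hb₂γ : ∀ t, b₂γ t = a * Real.exp (-(ω * t)) + ybar) :
    ∀ t : ℝ,
      -- (w₁, b₁) block
      deriv (fun s => F₁ s bhat (w₂γ t) (b₂γ t)) 0 =
        -(∑ i, (a * (ω / N) * Real.exp (-(ω * t)) + ybar - y i) *
            (a * σ bhat * deriv (deriv σ) bhat * Real.exp (-(ω * t))) * (x i) ^ 2) ∧
      deriv (fun s => F₁ 0 s (w₂γ t) (b₂γ t)) bhat =
        -(∑ i, (a * (ω / N) * Real.exp (-(ω * t)) + ybar - y i) *
            (a * σ bhat * deriv (deriv σ) bhat * Real.exp (-(ω * t))) * x i) ∧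
      deriv (fun s => F₂ s bhat (w₂γ t) (b₂γ t)) 0 =
        -(∑ i, (a * (ω / N) * Real.exp (-(ω * t)) + ybar - y i) *
            (a * σ bhat * deriv (deriv σ) bhat * Real.exp (-(ω * t))) * x i) ∧
      deriv (fun s => F₂ 0 s (w₂γ t) (b₂γ t)) bhat =
        -(∑ i, (a * (ω / N) * Real.exp (-(ω * t)) + ybar - y i) *
            (a * σ bhat * deriv (deriv σ) bhat * Real.exp (-(ω * t)))) ∧
      -- (w₂, b₂) block
      deriv (fun s => F₃ 0 bhat s (b₂γ t)) (w₂γ t) = -(N * σ bhat ^ 2) ∧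
      deriv (fun s => F₃ 0 bhat (w₂γ t) s) (b₂γ t) = -(N * σ bhat) ∧
      deriv (fun s => F₄ 0 bhat s (b₂γ t)) (w₂γ t) = -(N * σ bhat) ∧
      deriv (fun s => F₄ 0 bhat (w₂γ t) s) (b₂γ t) = -(N : ℝ) ∧
      -- vanishing cross entries
      deriv (fun s => F₁ 0 bhat s (b₂γ t)) (w₂γ t) = 0 ∧
      deriv (fun s => F₁ 0 bhat (w₂γ t) s) (b₂γ t) = 0 ∧
      deriv (fun s => F₂ 0 bhat s (b₂γ t)) (w₂γ t) = 0 ∧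
      deriv (fun s => F₂ 0 bhat (w₂γ t) s) (b₂γ t) = 0 ∧
      deriv (fun s => F₃ s bhat (w₂γ t) (b₂γ t)) 0 = 0 ∧
      deriv (fun s => F₃ 0 s (w₂γ t) (b₂γ t)) bhat = 0 ∧
      deriv (fun s => F₄ s bhat (w₂γ t) (b₂γ t)) 0 = 0 ∧
      deriv (fun s => F₄ 0 s (w₂γ t) (b₂γ t)) bhat = 0 := by
  have hd : Differentiable ℝ σ := hσ.differentiable (by norm_num)
  have hd' : Differentiable ℝ (deriv σ) := hσ.differentiable_deriv_two
  have hid (p : ℝ) : HasDerivAt (fun s : ℝ => s) 1 p := hasDerivAt_id' p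
  have hk (q p : ℝ) : HasDerivAt (fun _ : ℝ => q) 0 p := hasDerivAt_const p q
  have e₁ (w b u c : ℝ) : F₁ w b u c =
      -∑ i, (u * σ (w * x i + b) + c - y i) * (u * (deriv σ (w * x i + b) * x i)) := by
    simp only [hF₁, hR, deriv_quadratic_loss hd (hid w) (hk b w) (hk u w) (hk c w) x y]
    simp
  have e₂ (w b u c : ℝ) : F₂ w b u c =
      -∑ i, (u * σ (w * x i + b) + c - y i) * (u * (deriv σ (w * x i + b) * 1)) := by
    simp only [hF₂, hR, deriv_quadratic_loss hd (hk w b) (hid b) (hk u b) (hk c b) x y]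
    simp
  have e₃ (w b u c : ℝ) : F₃ w b u c =
      -∑ i, (u * σ (w * x i + b) + c - y i) * σ (w * x i + b) := by
    simp only [hF₃, hR, deriv_quadratic_loss hd (hk w u) (hk b u) (hid u) (hk c u) x y]
    simp
  have e₄ (w b u c : ℝ) : F₄ w b u c =
      -∑ i, (u * σ (w * x i + b) + c - y i) := by
    simp only [hF₄, hR, deriv_quadratic_loss hd (hk w c) (hk b c) (hk u c) (hid c) x y]
    simp
  intro t
  have hN0 : (N : ℝ) ≠ 0 := by positivity
  have hres : a * (ω / N) * Real.exp (-(ω * t)) + ybar = w₂γ t * σ bhat + b₂γ t := by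
    have hωN : ω / N = σ bhat ^ 2 + 1 := by rw [hω]; field_simp
    rw [hωN, hw₂γ, hb₂γ]
    ring
  have hcurv : a * σ bhat * deriv (deriv σ) bhat * Real.exp (-(ω * t)) =
      w₂γ t * deriv (deriv σ) bhat := by
    rw [hw₂γ]
    ring
  simp only [hres, hcurv, e₁, e₂, e₃, e₄]
  generalize w₂γ t = u, b₂γ t = c
  refine ⟨?_, ?_, ?_, ?_, ?_, ?_, ?_, ?_, ?_, ?_, ?_, ?_, ?_, ?_, ?_, ?_⟩
  · refine (deriv_inner_component hd hd' (hid 0) (hk bhat 0) (hk u 0) (hk c 0)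
      rfl hbhat x y x).trans ?_
    exact congrArg Neg.neg (sum_congr rfl fun i _ => by ring)
  · refine (deriv_inner_component hd hd' (hk 0 bhat) (hid bhat) (hk u bhat) (hk c bhat)
      rfl hbhat x y x).trans ?_
    exact congrArg Neg.neg (sum_congr rfl fun i _ => by ring)
  · refine (deriv_inner_component hd hd' (hid 0) (hk bhat 0) (hk u 0) (hk c 0)
      rfl hbhat x y fun _ => 1).trans ?_
    exact congrArg Neg.neg (sum_congr rfl fun i _ => by ring)
  · refine (deriv_inner_component hd hd' (hk 0 bhat) (hid bhat) (hk u bhat) (hk c bhat)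
      rfl hbhat x y fun _ => 1).trans ?_
    exact congrArg Neg.neg (sum_congr rfl fun i _ => by ring)
  · refine (deriv_outer_weight_component hd (hk 0 u) (hk bhat u) (hid u) (hk c u)
      rfl hbhat x y).trans ?_
    ring
  · refine (deriv_outer_weight_component hd (hk 0 c) (hk bhat c) (hk u c) (hid c)
      rfl hbhat x y).trans ?_
    ring
  · refine (deriv_outer_bias_component hd (hk 0 u) (hk bhat u) (hid u) (hk c u)
      rfl hbhat x y).trans ?_
    ring
  · refine (deriv_outer_bias_component hd (hk 0 c) (hk bhat c) (hk u c) (hid c)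
      rfl hbhat x y).trans ?_
    ring
  · refine (deriv_inner_component hd hd' (hk 0 u) (hk bhat u) (hid u) (hk c u)
      rfl hbhat x y x).trans ?_
    simp
  · refine (deriv_inner_component hd hd' (hk 0 c) (hk bhat c) (hk u c) (hid c)
      rfl hbhat x y x).trans ?_
    simp
  · refine (deriv_inner_component hd hd' (hk 0 u) (hk bhat u) (hid u) (hk c u)
      rfl hbhat x y fun _ => 1).trans ?_
    simp
  · refine (deriv_inner_component hd hd' (hk 0 c) (hk bhat c) (hk u c) (hid c)
      rfl hbhat x y fun _ => 1).trans ?_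
    simp
  · refine (deriv_outer_weight_component hd (hid 0) (hk bhat 0) (hk u 0) (hk c 0)
      rfl hbhat x y).trans ?_
    simp
  · refine (deriv_outer_weight_component hd (hk 0 bhat) (hid bhat) (hk u bhat) (hk c bhat)
      rfl hbhat x y).trans ?_
    simp
  · refine (deriv_outer_bias_component hd (hid 0) (hk bhat 0) (hk u 0) (hk c 0)
      rfl hbhat x y).trans ?_
    simp
  · refine (deriv_outer_bias_component hd (hk 0 bhat) (hid bhat) (hk u bhat) (hk c bhat)
      rfl hbhat x y).trans ?_
    simp
end

section
/- Assume x̄ ≠ 0, σ(b̂) ≠ 0, σ''(b̂) ≠ 0, and a ≠ 0. Suppose ε_{w₁}, ε_{b₁} : ℝ → ℝ are differentiable and satisfy the variational equations along γ. Define g_{w₁}(τ) = ε_{w₁}(−(1/ω)log τ) and g_{b₁}(τ) = ε_{b₁}(−(1/ω)log τ) for τ > 0 (so that τ = e^{−ωt}). Then for all τ > 0: g_{w₁}'(τ) = (A₁₁τ+B₁₁)g_{w₁}(τ) + (A₁₂τ+B₁₂)g_{b₁}(τ) and g_{b₁}'(τ) = (A₁₂τ+B₁₂)g_{w₁}(τ)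 + A₂₂τ·g_{b₁}(τ). -/
open Finset

/-- A sum of residuals against a linear form in `u` and `v`, expressed through moments. -/
lemma sum_residual_mul_linear {ι : Type*} (s : Finset ι) (r c u v : ℝ) (y p q : ι → ℝ) :
    ∑ i ∈ s, (r - y i) * c * (p i * u + q i * v) =
      c * ((r * ∑ i ∈ s, p i - ∑ i ∈ s, p i * y i) * u +
        (r * ∑ i ∈ s, q i - ∑ i ∈ s, q i * y i) * v) := by
  simp only [mul_sum, ← sum_sub_distrib, sum_mul, ← sum_add_distrib]
  exact sum_congr rfl fun i _ => by ring

/-- The chain rule for the substitution `t = -(1 / ω) * log τ`. -/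
lemma HasDerivAt.comp_neg_inv_mul_log {f : ℝ → ℝ} {f' ω τ : ℝ} (hτ : 0 < τ)
    (hf : HasDerivAt f f' (-(1 / ω) * Real.log τ)) :
    HasDerivAt (fun τ => f (-(1 / ω) * Real.log τ)) (f' * (-(1 / ω) * τ⁻¹)) τ :=
  hf.comp τ ((Real.hasDerivAt_log hτ.ne').const_mul _)

/-- After the change of variable `τ = e^{−ωt}`, the `(ε_{w₁}, ε_{b₁})` block of the
variational equation along `γ` becomes a 2×2 linear system with affine-in-`τ`
coefficients. -/
theorem variational_block_in_tau_variable
    (N : ℕ) (hN : 1 ≤ N) (x y : Fin N → ℝ)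
    (σ : ℝ → ℝ) (hσ : ContDiff ℝ 2 σ)
    (bhat : ℝ) (hbhat : deriv σ bhat = 0) (bhat₂ : ℝ)
    (xbar ybar x2bar xybar x2ybar a ω : ℝ)
    (hxbar : xbar = (∑ i, x i) / N)
    (hybar : ybar = (∑ i, y i) / N)
    (hx2bar : x2bar = (∑ i, (x i) ^ 2) / N)
    (hxybar : xybar = (∑ i, x i * y i) / N)
    (hx2ybar : x2ybar = (∑ i, (x i) ^ 2 * y i) / N)
    (ha : a = bhat₂ - ybar)
    (hω : ω = N * (σ bhat ^ 2 + 1))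
    (hxbar_ne : xbar ≠ 0) (hσb : σ bhat ≠ 0) (hσ'' : deriv (deriv σ) bhat ≠ 0)
    (ha_ne : a ≠ 0)
    (εw εb : ℝ → ℝ)
    (hεw : ∀ t : ℝ, HasDerivAt εw
      (-(∑ i, (a * (ω / N) * Real.exp (-(ω * t)) + ybar - y i) *
          (a * σ bhat * deriv (deriv σ) bhat * Real.exp (-(ω * t))) *
          ((x i) ^ 2 * εw t + x i * εb t))) t)
    (hεb : ∀ t : ℝ, HasDerivAt εb
      (-(∑ i, (a * (ω / N) * Real.exp (-(ω * t)) + ybar - y i) *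
          (a * σ bhat * deriv (deriv σ) bhat * Real.exp (-(ω * t))) *
          (x i * εw t + εb t))) t)
    (gw gb : ℝ → ℝ)
    (hgw : ∀ τ : ℝ, gw τ = εw (-(1 / ω) * Real.log τ))
    (hgb : ∀ τ : ℝ, gb τ = εb (-(1 / ω) * Real.log τ))
    (A₁₁ B₁₁ A₁₂ B₁₂ A₂₂ : ℝ)
    (hA₁₁ : A₁₁ = a ^ 2 * σ bhat * deriv (deriv σ) bhat * x2bar)
    (hB₁₁ : B₁₁ = (N / ω) * a * σ bhat * deriv (deriv σ) bhat * (x2bar * ybar - x2ybar))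
    (hA₁₂ : A₁₂ = a ^ 2 * σ bhat * deriv (deriv σ) bhat * xbar)
    (hB₁₂ : B₁₂ = (N / ω) * a * σ bhat * deriv (deriv σ) bhat * (xbar * ybar - xybar))
    (hA₂₂ : A₂₂ = a ^ 2 * σ bhat * deriv (deriv σ) bhat) :
    ∀ τ : ℝ, 0 < τ →
      HasDerivAt gw ((A₁₁ * τ + B₁₁) * gw τ + (A₁₂ * τ + B₁₂) * gb τ) τ ∧
      HasDerivAt gb ((A₁₂ * τ + B₁₂) * gw τ + A₂₂ * τ * gb τ) τ := by
  intro τ hτ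
  have hN0 : (N : ℝ) ≠ 0 := by positivity
  have hω0 : ω ≠ 0 := by rw [hω]; positivity
  have hexp : Real.exp (-(ω * (-(1 / ω) * Real.log τ))) = τ := by
    rw [show -(ω * (-(1 / ω) * Real.log τ)) = Real.log τ by field_simp, Real.exp_log hτ]
  have hS1 : ∑ i, x i = N * xbar := by rw [hxbar]; field_simp
  have hSy : ∑ i, y i = N * ybar := by rw [hybar]; field_simp
  have hS2 : ∑ i, x i ^ 2 = N * x2bar := by rw [hx2bar]; field_simp
  have hS1y : ∑ i, x i * y i = N * xybar := by rw [hxybar]; field_simp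
  have hS2y : ∑ i, x i ^ 2 * y i = N * x2ybar := by rw [hx2ybar]; field_simp
  have hw := (hεw (-(1 / ω) * Real.log τ)).comp_neg_inv_mul_log hτ
  have hb := (hεb (-(1 / ω) * Real.log τ)).comp_neg_inv_mul_log hτ
  rw [← funext hgw] at hw
  rw [← funext hgb] at hb
  rw [hexp, ← hgw, ← hgb] at hw hb
  constructor
  · convert hw using 1
    rw [sum_residual_mul_linear univ _ _ _ _ y (fun i => x i ^ 2) x, hS1, hS2, hS1y, hS2y,
      hA₁₁, hB₁₁, hA₁₂, hB₁₂]
    field_simp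
    ring
  · convert hb using 1
    have key := sum_residual_mul_linear univ (a * (ω / N) * τ + ybar)
      (a * σ bhat * deriv (deriv σ) bhat * τ) (gw τ) (gb τ) y x (fun _ => 1)
    simp only [one_mul, sum_const, card_univ, Fintype.card_fin, nsmul_eq_mul, mul_one] at key
    rw [key, hS1, hSy, hS1y, hA₁₂, hB₁₂, hA₂₂]
    field_simp
    ring
end
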